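/- Let f : [0,1] → (0,∞) be log-convex, i.e. f(λ t₁ + (1−λ) t₂) ≤ f(t₁)^{λ} f(t₂)^{1−λ} for all t₁, t₂ ∈ [0,1] and λ ∈ [0,1]. Then for every t ∈ [0,1] and N ∈ ℕ, K( (f(1)/f(0))^{1/2^{N}}, 2 )^{β_N(t)} · f(t) + S_N( t; f(1), f(0) ) ≤ t f(1) + (1−t) f(0). -/

import Mathlib

open Real Finset

noncomputable def kj (j : ℕ) (ν : ℝ) : ℤ := ⌊(2:ℝ)^(j-1) * ν⌋

noncomputable def rj (j : ℕ) (ν : ℝ) : ℤ := ⌊(2:ℝ)^j * ν⌋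

noncomputable def sj (j : ℕ) (ν : ℝ) : ℝ :=
  (-1:ℝ)^(rj j ν) * (2:ℝ)^(j-1) * ν
    + (-1:ℝ)^(rj j ν + 1) * (⌊((rj j ν : ℝ) + 1)/2⌋ : ℤ)

noncomputable def SS (N : ℕ) (ν a b : ℝ) : ℝ :=
  ∑ j ∈ Finset.Icc 1 N, sj j ν *
    ((b ^ ((2:ℝ)^(j-1) - (kj j ν : ℝ)) * a ^ ((kj j ν : ℝ))) ^ ((1:ℝ)/2^j)
      - (a ^ ((kj j ν : ℝ) + 1) * b ^ ((2:ℝ)^(j-1) - (kj j ν : ℝ) - 1)) ^ ((1:ℝ)/2^j))^2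

noncomputable def Kc (t : ℝ) : ℝ := (t + 1)^2 / (4 * t)

noncomputable def betaN (N : ℕ) (ν : ℝ) : ℝ :=
  min (1 + (⌊(2:ℝ)^N * ν⌋ : ℝ) - (2:ℝ)^N * ν) ((2:ℝ)^N * ν - (⌊(2:ℝ)^N * ν⌋ : ℝ))

/-- The piecewise linear interpolation, at the dyadic points of level `N`, of the weighted geometric
mean `t ↦ exp (t A + (1 - t) B)` of `exp A` and `exp B`. -/
noncomputable def dyadicInterp (A B : ℝ) (N : ℕ) (t : ℝ) : ℝ :=
  (1 + (⌊(2:ℝ)^N * t⌋ : ℝ) - (2:ℝ)^N * t) * exp (B + ⌊(2:ℝ)^N * t⌋ / (2:ℝ)^N * (A - B))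
    + ((2:ℝ)^N * t - ⌊(2:ℝ)^N * t⌋) * exp (B + (⌊(2:ℝ)^N * t⌋ + 1) / (2:ℝ)^N * (A - B))

lemma sj_succ_of_rj_eq_two_mul {n : ℕ} {t : ℝ} {k : ℤ} (h : rj (n + 1) t = 2 * k) :
    sj (n + 1) t = (2:ℝ)^n * t - k := by
  have hf : ⌊((2 * k : ℤ) + 1 : ℝ) / 2⌋ = k := by
    rw [Int.floor_eq_iff]; push_cast; constructor <;> linarith
  have h1 : (-1:ℝ)^(2 * k) = 1 := (even_two_mul k).neg_one_zpow
  have h2 : (-1:ℝ)^(2 * k + 1) = -1 := (odd_two_mul_add_one k).neg_one_zpow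
  rw [sj, h, hf, h1, h2, Nat.add_sub_cancel]
  ring

lemma sj_succ_of_rj_eq_two_mul_add_one {n : ℕ} {t : ℝ} {k : ℤ}
    (h : rj (n + 1) t = 2 * k + 1) : sj (n + 1) t = k + 1 - (2:ℝ)^n * t := by
  have hf : ⌊((2 * k + 1 : ℤ) + 1 : ℝ) / 2⌋ = k + 1 := by
    rw [Int.floor_eq_iff]; push_cast; constructor <;> linarith
  have h1 : (-1:ℝ)^(2 * k + 1) = -1 := (odd_two_mul_add_one k).neg_one_zpow
  have h2 : (-1:ℝ)^(2 * k + 1 + 1) = 1 := by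
    rw [show 2 * k + 1 + 1 = 2 * (k + 1) by ring]
    exact (even_two_mul _).neg_one_zpow
  rw [sj, h, hf, h1, h2, Nat.add_sub_cancel]
  push_cast
  ring

lemma exp_rpow_mul_exp_rpow_rpow (A B x y z : ℝ) :
    (exp A ^ x * exp B ^ y) ^ z = exp ((A * x + B * y) * z) := by
  rw [← exp_mul, ← exp_mul, ← exp_add, ← exp_mul]

lemma dyadicInterp_succ (A B : ℝ) (n : ℕ) (t : ℝ) :
    dyadicInterp A B (n + 1) t + sj (n + 1) t *
    ((exp B ^ ((2:ℝ)^(n + 1 - 1) - (kj (n + 1) t : ℝ)) * exp A ^ ((kj (n + 1) t : ℝ)))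
        ^ ((1:ℝ)/2^(n + 1))
      - (exp A ^ ((kj (n + 1) t : ℝ) + 1) * exp B ^ ((2:ℝ)^(n + 1 - 1) - (kj (n + 1) t : ℝ) - 1))
        ^ ((1:ℝ)/2^(n + 1)))^2
      = dyadicInterp A B n t := by
  have hp : (2:ℝ)^n ≠ 0 := by positivity
  obtain ⟨k, hk⟩ : ∃ k, ⌊(2:ℝ)^n * t⌋ = k := ⟨_, rfl⟩
  have hkj : kj (n + 1) t = k := by simpa [kj] using hk
  obtain ⟨hk1, hk2⟩ := Int.floor_eq_iff.mp hk
  have key : ∀ x : ℝ, (2:ℝ)^(n + 1) * x = 2 * ((2:ℝ)^n * x) := fun x => by ring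
  set u := exp ((B + k / (2:ℝ)^n * (A - B)) / 2) with hu
  set v := exp ((B + (k + 1) / (2:ℝ)^n * (A - B)) / 2) with hv
  have hleft : exp (B + k / (2:ℝ)^n * (A - B)) = u * u := by
    rw [hu, ← exp_add]; ring_nf
  have hright : exp (B + (k + 1) / (2:ℝ)^n * (A - B)) = v * v := by
    rw [hv, ← exp_add]; ring_nf
  have hmid : exp (B + (2 * k + 1) / (2:ℝ)^(n + 1) * (A - B)) = u * v := by
    rw [hu, hv, ← exp_add]; congr 1; field_simp; ring
  have e1 : exp ((B * ((2:ℝ)^n - k) + A * k) * (1 / 2^(n + 1))) = u := by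
    rw [hu]; congr 1; field_simp; ring
  have e2 : exp ((A * (k + 1) + B * ((2:ℝ)^n - k - 1)) * (1 / 2^(n + 1))) = v := by
    rw [hv]; congr 1; field_simp; ring
  rw [hkj, exp_rpow_mul_exp_rpow_rpow, exp_rpow_mul_exp_rpow_rpow, Nat.add_sub_cancel, e1, e2]
  rcases lt_or_ge ((2:ℝ)^n * t) (k + 1 / 2) with h | h
  · have hr : ⌊(2:ℝ)^(n + 1) * t⌋ = 2 * k := by
      rw [Int.floor_eq_iff, key]; push_cast; constructor <;> linarith
    have e3 : (2 * k : ℝ) / (2:ℝ)^(n + 1) = k / 2^n := by field_simp; ring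
    rw [sj_succ_of_rj_eq_two_mul hr, dyadicInterp, dyadicInterp, hr, hk]
    push_cast
    rw [hmid, e3, hleft, hright, key]
    ring
  · have hr : ⌊(2:ℝ)^(n + 1) * t⌋ = 2 * k + 1 := by
      rw [Int.floor_eq_iff, key]; push_cast; constructor <;> linarith
    have e3 : (2 * k + 1 + 1 : ℝ) / (2:ℝ)^(n + 1) = (k + 1) / 2^n := by field_simp; ring
    rw [sj_succ_of_rj_eq_two_mul_add_one hr, dyadicInterp, dyadicInterp, hr, hk]
    push_cast
    rw [hmid, e3, hleft, hright, key]
    ring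

lemma dyadicInterp_zero (A B t : ℝ) (ht : t ∈ Set.Icc (0:ℝ) 1) :
    dyadicInterp A B 0 t = t * exp A + (1 - t) * exp B := by
  rcases ht.2.lt_or_eq with h | rfl
  · have hf : ⌊t⌋ = 0 := Int.floor_eq_zero_iff.mpr ⟨ht.1, h⟩
    simp [dyadicInterp, hf]
    ring
  · simp [dyadicInterp]

lemma dyadicInterp_add_SS (A B : ℝ) (N : ℕ) (t : ℝ) :
    dyadicInterp A B N t + SS N t (exp A) (exp B) = dyadicInterp A B 0 t := by
  induction N with
  | zero => simp [SS]
  | succ n ih =>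
    have h : SS (n + 1) t (exp A) (exp B) = SS n t (exp A) (exp B) + _ :=
      Finset.sum_Icc_succ_top (Nat.le_add_left 1 n) _
    rw [h, ← ih, ← dyadicInterp_succ A B n t]
    ring

/-- Young's inequality refined by the Kantorovich constant, for the smaller weight on `v`. -/
lemma Kc_rpow_mul_le_of_le_half {u v θ : ℝ} (hu : 0 < u) (hv : 0 < v) (h0 : 0 ≤ θ)
    (h : θ ≤ 1 / 2) :
    Kc (v / u) ^ θ * (u ^ (1 - θ) * v ^ θ) ≤ (1 - θ) * u + θ * v := by
  have hK : Kc (v / u) * (u * v) = ((u + v) / 2) ^ (2:ℝ) := by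
    rw [Kc, rpow_two]; field_simp; ring
  have hK0 : 0 < Kc (v / u) := by unfold Kc; positivity
  calc Kc (v / u) ^ θ * (u ^ (1 - θ) * v ^ θ)
      = u ^ (1 - 2 * θ) * (Kc (v / u) * (u * v)) ^ θ := by
        rw [mul_rpow hK0.le (by positivity), mul_rpow hu.le hv.le,
          show 1 - θ = (1 - 2 * θ) + θ by ring, rpow_add hu]
        ring
    _ = u ^ (1 - 2 * θ) * ((u + v) / 2) ^ (2 * θ) := by
        rw [hK, ← rpow_mul (by positivity)]
    _ ≤ (1 - 2 * θ) * u + 2 * θ * ((u + v) / 2) :=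
        geom_mean_le_arith_mean2_weighted (by linarith) (by linarith) hu.le (by positivity)
          (by ring)
    _ = (1 - θ) * u + θ * v := by ring

lemma Kc_inv {x : ℝ} (hx : x ≠ 0) : Kc x⁻¹ = Kc x := by
  unfold Kc; field_simp; ring

/-- Young's inequality refined by the Kantorovich constant. -/
lemma Kc_rpow_min_mul_le {u v θ : ℝ} (hu : 0 < u) (hv : 0 < v) (h0 : 0 ≤ θ) (h1 : θ ≤ 1) :
    Kc (v / u) ^ min (1 - θ) θ * (u ^ (1 - θ) * v ^ θ) ≤ (1 - θ) * u + θ * v := by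
  rcases le_total θ (1 / 2) with h | h
  · rw [min_eq_right (by linarith)]
    exact Kc_rpow_mul_le_of_le_half hu hv h0 h
  · rw [min_eq_left (by linarith), ← Kc_inv (by positivity), inv_div]
    have := Kc_rpow_mul_le_of_le_half (θ := 1 - θ) hv hu (by linarith) (by linarith)
    rw [sub_sub_cancel] at this
    linarith [mul_comm (u ^ (1 - θ)) (v ^ θ) ▸ this]

lemma Kc_rpow_betaN_mul_exp_le_dyadicInterp (A B : ℝ) (N : ℕ) (t : ℝ) :
    Kc ((exp A / exp B) ^ ((1:ℝ)/2^N)) ^ betaN N t * exp (A * t + B * (1 - t))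
      ≤ dyadicInterp A B N t := by
  have hp : (2:ℝ)^N ≠ 0 := by positivity
  have h := Kc_rpow_min_mul_le (exp_pos (B + ⌊(2:ℝ)^N * t⌋ / (2:ℝ)^N * (A - B)))
    (exp_pos (B + (⌊(2:ℝ)^N * t⌋ + 1) / (2:ℝ)^N * (A - B)))
    (Int.fract_nonneg ((2:ℝ)^N * t)) (Int.fract_lt_one _).le
  have hfract : (1:ℝ) - Int.fract ((2:ℝ)^N * t) = 1 + ⌊(2:ℝ)^N * t⌋ - (2:ℝ)^N * t := by
    rw [← Int.self_sub_floor]; ring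
  rw [hfract, ← Int.self_sub_floor, ← exp_sub, ← exp_mul, ← exp_mul, ← exp_add] at h
  have hratio : B + (⌊(2:ℝ)^N * t⌋ + 1) / (2:ℝ)^N * (A - B) - (B + ⌊(2:ℝ)^N * t⌋ / (2:ℝ)^N * (A - B))
      = (A - B) * (1 / 2^N) := by
    ring
  have hmean : (B + ⌊(2:ℝ)^N * t⌋ / (2:ℝ)^N * (A - B)) * (1 + ⌊(2:ℝ)^N * t⌋ - (2:ℝ)^N * t)
      + (B + (⌊(2:ℝ)^N * t⌋ + 1) / (2:ℝ)^N * (A - B)) * ((2:ℝ)^N * t - ⌊(2:ℝ)^N * t⌋)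
      = A * t + B * (1 - t) := by
    generalize (⌊(2:ℝ)^N * t⌋ : ℝ) = m
    field_simp
    ring
  rw [hratio, hmean] at h
  rwa [← exp_sub, ← exp_mul, dyadicInterp, betaN]

theorem stmt14 (f : ℝ → ℝ) (hpos : ∀ x ∈ Set.Icc (0:ℝ) 1, 0 < f x)
    (hlc : ∀ t₁ ∈ Set.Icc (0:ℝ) 1, ∀ t₂ ∈ Set.Icc (0:ℝ) 1, ∀ l ∈ Set.Icc (0:ℝ) 1,
      f (l * t₁ + (1 - l) * t₂) ≤ f t₁ ^ l * f t₂ ^ (1 - l))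
    (t : ℝ) (ht : t ∈ Set.Icc (0:ℝ) 1) (N : ℕ) :
    Kc ((f 1 / f 0) ^ ((1:ℝ)/2^N)) ^ (betaN N t) * f t + SS N t (f 1) (f 0)
      ≤ t * f 1 + (1 - t) * f 0 := by
  have h1 := hpos 1 (by simp)
  have h0 := hpos 0 (by simp)
  have hft : f t ≤ exp (log (f 1) * t + log (f 0) * (1 - t)) := by
    have := hlc 1 (by simp) 0 (by simp) t ht
    rw [rpow_def_of_pos h1, rpow_def_of_pos h0, ← exp_add] at this
    simpa using this
  have hK : 0 ≤ Kc ((f 1 / f 0) ^ ((1:ℝ)/2^N)) ^ betaN N t := by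
    unfold Kc; positivity
  have hle := Kc_rpow_betaN_mul_exp_le_dyadicInterp (log (f 1)) (log (f 0)) N t
  have hS := dyadicInterp_add_SS (log (f 1)) (log (f 0)) N t
  rw [dyadicInterp_zero _ _ t ht] at hS
  rw [exp_log h1, exp_log h0] at hle hS
  linarith [mul_le_mul_of_nonneg_left hft hK]
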